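/- arXiv:1904.08787 — 5 statements merged into one kernel-verified Lean document; each statement's English description precedes it below -/
import Mathlib

section
/- Let A₁ ∈ ℝ^{k×k} be a symmetric positive definite matrix with minimum eigenvalue λ_min(A₁). For any x ∈ ℝ^k with x ≠ 0 and any y ∈ ℝ^k satisfying ‖y‖₂ < λ_min(A₁)·‖x‖₂, there exists a symmetric positive definite matrix A₂ ∈ ℝ^{k×k} such that A₂ x = A₁ x + y and λ_min(A₂) ≥ λ_min(A₁) − ‖y‖₂/‖x‖₂. -/
open Matrix

/-- Euclidean (ℓ2) norm of a finite-dimensional real vector. -/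
noncomputable def l2norm {ι : Type*} [Fintype ι] (v : ι → ℝ) : ℝ :=
  Real.sqrt (∑ i, v i ^ 2)

/-- Minimum eigenvalue of a real symmetric (Hermitian) matrix. -/
noncomputable def lamMin {k : ℕ} {A : Matrix (Fin k) (Fin k) ℝ}
    (hA : A.IsHermitian) : ℝ :=
  ⨅ i, hA.eigenvalues i

/-- The quadratic form of a Hermitian matrix dominates its minimum eigenvalue. -/
lemma lamMin_mul_dotProduct_le {k : ℕ} {A : Matrix (Fin k) (Fin k) ℝ} (hA : A.IsHermitian)
    (v : Fin k → ℝ) : lamMin hA * (v ⬝ᵥ v) ≤ v ⬝ᵥ (A *ᵥ v) := by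
  have hD : (diagonal fun i => hA.eigenvalues i - lamMin hA).PosSemidef := by
    refine PosSemidef.diagonal fun i => ?_
    exact sub_nonneg.2 (ciInf_le (Set.finite_range _).bddBelow i)
  set U : Matrix (Fin k) (Fin k) ℝ := (hA.eigenvectorUnitary).1
  have hUU : U * Uᴴ = 1 := Unitary.coe_mul_star_self hA.eigenvectorUnitary
  have hspec : A = U * diagonal hA.eigenvalues * Uᴴ := by
    simpa [Unitary.conjStarAlgAut_apply, star_eq_conjTranspose] using hA.spectral_theorem
  have hshift : A - lamMin hA • 1
      = U * (diagonal fun i => hA.eigenvalues i - lamMin hA) * Uᴴ := by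
    have hdiag : (diagonal fun i => hA.eigenvalues i - lamMin hA)
        = diagonal hA.eigenvalues - lamMin hA • (1 : Matrix (Fin k) (Fin k) ℝ) := by
      rw [smul_one_eq_diagonal, diagonal_sub]
    rw [hdiag, mul_sub, sub_mul, ← hspec, mul_smul_comm, mul_one, smul_mul_assoc, hUU]
  have hpos := (hD.mul_mul_conjTranspose_same U).dotProduct_mulVec_nonneg v
  rw [← hshift] at hpos
  simpa [sub_mulVec, smul_mulVec] using hpos

/-- A lower bound of the quadratic form is a lower bound of the minimum eigenvalue. -/
lemma le_lamMin {k : ℕ} [NeZero k] {A : Matrix (Fin k) (Fin k) ℝ} (hA : A.IsHermitian) {b : ℝ}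
    (hb : ∀ v : Fin k → ℝ, b * (v ⬝ᵥ v) ≤ v ⬝ᵥ (A *ᵥ v)) : b ≤ lamMin hA := by
  refine le_ciInf fun i => ?_
  have hunit : (hA.eigenvectorBasis i).ofLp ⬝ᵥ (hA.eigenvectorBasis i).ofLp = 1 := by
    have h := hA.eigenvectorBasis.inner_eq_one i
    rwa [EuclideanSpace.inner_eq_star_dotProduct, star_trivial] at h
  have h := hb (hA.eigenvectorBasis i)
  rw [hA.mulVec_eigenvectorBasis, dotProduct_smul, hunit] at h
  simpa using h

lemma l2norm_nonneg {ι : Type*} [Fintype ι] (v : ι → ℝ) : 0 ≤ l2norm v :=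
  Real.sqrt_nonneg _

lemma l2norm_sq {ι : Type*} [Fintype ι] (v : ι → ℝ) : l2norm v ^ 2 = v ⬝ᵥ v := by
  rw [l2norm, Real.sq_sqrt (Finset.sum_nonneg fun i _ => sq_nonneg _)]
  simp [dotProduct, sq]

lemma l2norm_pos {ι : Type*} [Fintype ι] {v : ι → ℝ} (hv : v ≠ 0) : 0 < l2norm v := by
  refine (l2norm_nonneg v).lt_of_ne' fun h => hv ?_
  rw [← dotProduct_self_eq_zero, ← l2norm_sq, h, zero_pow two_ne_zero]

lemma dotProduct_sq_le {ι : Type*} [Fintype ι] (v w : ι → ℝ) :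
    (v ⬝ᵥ w) ^ 2 ≤ (v ⬝ᵥ v) * (w ⬝ᵥ w) := by
  simpa [dotProduct, sq] using Finset.sum_mul_sq_le_sq_mul_sq Finset.univ v w

/-- A scaled Householder reflection is a symmetric matrix sending `x` to `y`, with quadratic form
bounded below by `-c`, whenever `‖y‖ = c ‖x‖`. -/
lemma exists_isHermitian_mulVec_eq {ι : Type*} [Fintype ι] [DecidableEq ι] (x y : ι → ℝ)
    {c : ℝ} (hc : 0 ≤ c) (hxy : y ⬝ᵥ y = c ^ 2 * (x ⬝ᵥ x)) :
    ∃ E : Matrix ι ι ℝ, E.IsHermitian ∧ E *ᵥ x = y ∧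
      ∀ v : ι → ℝ, -c * (v ⬝ᵥ v) ≤ v ⬝ᵥ (E *ᵥ v) := by
  set w := c • x - y with hw
  have hmul (v : ι → ℝ) : (c • (1 : Matrix ι ι ℝ) - (2 * c / (w ⬝ᵥ w)) • vecMulVec w w) *ᵥ v
      = c • v - (2 * c / (w ⬝ᵥ w) * (w ⬝ᵥ v)) • w := by
    simp [sub_mulVec, smul_mulVec, vecMulVec_mulVec, smul_smul]
  refine ⟨c • 1 - (2 * c / (w ⬝ᵥ w)) • vecMulVec w w, ?_, ?_, fun v => ?_⟩
  · ext i j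
    simp [vecMulVec_apply, one_apply, eq_comm, mul_comm (w i)]
  · rw [hmul]
    have hww : w ⬝ᵥ w = 2 * c * (w ⬝ᵥ x) := by
      simp only [hw, sub_dotProduct, dotProduct_sub, smul_dotProduct, dotProduct_smul, hxy,
        smul_eq_mul, dotProduct_comm y x]
      ring
    by_cases h0 : w ⬝ᵥ w = 0
    · have hw0 : w = 0 := dotProduct_self_eq_zero.1 h0
      rw [hw0, smul_zero, sub_zero]
      exact sub_eq_zero.1 (hw.symm.trans hw0)
    · rw [div_mul_eq_mul_div, ← hww, div_self h0, one_smul, hw, sub_sub_cancel]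
  · rw [hmul, dotProduct_sub, dotProduct_smul, dotProduct_smul, smul_eq_mul, smul_eq_mul,
      dotProduct_comm w v]
    have hquot : (v ⬝ᵥ w) ^ 2 / (w ⬝ᵥ w) ≤ v ⬝ᵥ v :=
      div_le_of_le_mul₀ (by simpa using dotProduct_star_self_nonneg w)
        (by simpa using dotProduct_star_self_nonneg v) (dotProduct_sq_le v w)
    have hrw : 2 * c / (w ⬝ᵥ w) * (v ⬝ᵥ w) * (v ⬝ᵥ w)
        = 2 * c * ((v ⬝ᵥ w) ^ 2 / (w ⬝ᵥ w)) := by ring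
    rw [hrw]
    linarith [mul_le_mul_of_nonneg_left hquot (mul_nonneg zero_le_two hc)]

/-- Let `A₁ ∈ ℝ^{k×k}` be symmetric positive definite with minimum eigenvalue
`λ_min(A₁)`. For any `x ≠ 0` and `y` with `‖y‖₂ < λ_min(A₁)·‖x‖₂`, there exists a symmetric
positive definite `A₂` with `A₂ x = A₁ x + y` and `λ_min(A₂) ≥ λ_min(A₁) − ‖y‖₂/‖x‖₂`. -/
theorem stmt4 (k : ℕ) (A₁ : Matrix (Fin k) (Fin k) ℝ) (hA₁ : A₁.PosDef)
    (x y : Fin k → ℝ) (hx : x ≠ 0)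
    (hy : l2norm y < lamMin hA₁.1 * l2norm x) :
    ∃ (A₂ : Matrix (Fin k) (Fin k) ℝ) (hA₂ : A₂.PosDef),
      A₂ *ᵥ x = A₁ *ᵥ x + y ∧
      lamMin hA₁.1 - l2norm y / l2norm x ≤ lamMin hA₂.1 := by
  have hxpos := l2norm_pos hx
  have : NeZero k := ⟨by rintro rfl; exact hx (Subsingleton.elim _ _)⟩
  obtain ⟨E, hE, hEx, hEv⟩ := exists_isHermitian_mulVec_eq x y
    (div_nonneg (l2norm_nonneg y) hxpos.le)
    (by rw [← l2norm_sq, ← l2norm_sq, div_pow, div_mul_cancel₀ _ (pow_pos hxpos 2).ne'])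
  have hquad (v : Fin k → ℝ) :
      (lamMin hA₁.1 - l2norm y / l2norm x) * (v ⬝ᵥ v) ≤ v ⬝ᵥ ((A₁ + E) *ᵥ v) := by
    rw [add_mulVec, dotProduct_add]
    linarith [lamMin_mul_dotProduct_le hA₁.1 v, hEv v]
  have hgap : 0 < lamMin hA₁.1 - l2norm y / l2norm x := sub_pos.2 ((div_lt_iff₀ hxpos).2 hy)
  have hpos : (A₁ + E).PosDef := by
    refine PosDef.of_dotProduct_mulVec_pos (hA₁.1.add hE) fun v hv => ?_
    rw [star_trivial]
    refine (mul_pos hgap ?_).trans_le (hquad v)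
    rw [← l2norm_sq]
    exact pow_pos (l2norm_pos hv) 2
  exact ⟨A₁ + E, hpos, by rw [add_mulVec, hEx], le_lamMin hpos.1 hquad⟩
end

section
/- Let (F_t) be a filtration and let {r(t)} be an F_{t+1}-adapted process such that, for some constants c_r > 0 and 0 < δ₂ < 1: 0 ≤ r(t) ≤ 1 almost surely and E[r(t) | F_t] ≥ c_r/(t+1)^{δ₂} almost surely, for all t. Let r₁(t) = c₁/(t+1)^{δ₁} with c₁ > 0 and δ₂ < δ₁. Let w_0 ≥ 0 be F_0-measurable and define w_{t+1} = (1 − r(t)) w_t + r₁(t). Then for every δ₀ with 0 ≤ δ₀ < δ₁ − δ₂, with probability 1, lim_{t→∞} (t+1)^{δ₀} w_t = 0. -/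
open MeasureTheory ProbabilityTheory Filter

/-- A weighted convexity bound for the power of a sum. -/
lemma add_pow_succ_le_div_add_div {x y θ : ℝ} (hx : 0 ≤ x) (hy : 0 ≤ y) (hθ : 0 < θ)
    (hθ1 : θ < 1) (k : ℕ) :
    (x + y) ^ (k + 1) ≤ x ^ (k + 1) / (1 - θ) ^ k + y ^ (k + 1) / θ ^ k := by
  have h1 : 0 < 1 - θ := by linarith
  have h := (convexOn_pow (𝕜 := ℝ) (k + 1)).2 (x := x / (1 - θ)) (y := y / θ)
    (div_nonneg hx h1.le) (div_nonneg hy hθ.le) h1.le hθ.le (by ring)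
  simp only [smul_eq_mul] at h
  rw [mul_div_cancel₀ _ h1.ne', mul_div_cancel₀ _ hθ.ne'] at h
  refine h.trans_eq ?_
  rw [div_pow, div_pow, pow_succ (1 - θ), pow_succ θ]
  field_simp

lemma one_sub_div_pow_le {p : ℝ} (hp : 0 ≤ p) (hp1 : p ≤ 1) (k : ℕ) :
    (1 - p) / (1 - p / (2 * (k + 1))) ^ k ≤ 1 - p / 2 := by
  have hk : (0 : ℝ) ≤ k := k.cast_nonneg
  set θ := p / (2 * ((k : ℝ) + 1)) with hθ
  have hθ0 : 0 ≤ θ := by positivity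
  have hθp : 2 * (k + 1) * θ = p := by rw [hθ]; field_simp
  have hθ1 : θ < 1 := by nlinarith
  have hb := one_add_mul_le_pow (a := -θ) (by linarith) k
  rw [← sub_eq_add_neg] at hb
  rw [div_le_iff₀ (pow_pos (by linarith) k)]
  nlinarith

lemma add_two_rpow_neg_ge {β : ℝ} (hβ : 0 ≤ β) (t : ℕ) :
    ((t : ℝ) + 1) ^ (-β) * (1 - β / (t + 1)) ≤ ((t : ℝ) + 2) ^ (-β) := by
  have ht : (0 : ℝ) < t + 1 := by positivity
  have hsplit : (t : ℝ) + 2 = (t + 1) * (1 + 1 / (t + 1)) := by field_simp; ring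
  rw [hsplit, Real.mul_rpow ht.le (by positivity)]
  gcongr
  have h1 : (1 + 1 / ((t : ℝ) + 1)) ^ β ≤ Real.exp (β / (t + 1)) := by
    calc (1 + 1 / ((t : ℝ) + 1)) ^ β ≤ (Real.exp (1 / (t + 1))) ^ β := by
          gcongr
          linarith [Real.add_one_le_exp (1 / ((t : ℝ) + 1))]
      _ = Real.exp (β / (t + 1)) := by rw [← Real.exp_mul]; congr 1; ring
  rw [Real.rpow_neg (by positivity)]
  calc 1 - β / ((t : ℝ) + 1) ≤ Real.exp (-(β / (t + 1))) := by
        linarith [Real.add_one_le_exp (-(β / ((t : ℝ) + 1)))]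
    _ = (Real.exp (β / (t + 1)))⁻¹ := Real.exp_neg _
    _ ≤ _ := by gcongr

/-- Decay rate of a sequence satisfying a linear recursive inequality with contraction
`c / (t + 1) ^ δ`, `δ < 1`. -/
lemma exists_eventually_le_rpow_neg_of_recursion {x : ℕ → ℝ} {c C δ β : ℝ} (hc : 0 < c)
    (hδ : 0 < δ) (hδ1 : δ < 1) (hβ : 0 ≤ β)
    (hx : ∀ t : ℕ, x (t + 1) ≤
      (1 - c * ((t : ℝ) + 1) ^ (-δ)) * x t + C * ((t : ℝ) + 1) ^ (-δ - β)) :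
    ∃ K : ℝ, ∀ᶠ t : ℕ in atTop, x t ≤ K * ((t : ℝ) + 1) ^ (-β) := by
  have hlim : Tendsto (fun t : ℕ => (t : ℝ) + 1) atTop atTop :=
    tendsto_atTop_add_const_right _ _ tendsto_natCast_atTop_atTop
  have e1 : ∀ᶠ t : ℕ in atTop, c * ((t : ℝ) + 1) ^ (-δ) < 1 := by
    have := ((tendsto_rpow_neg_atTop hδ).comp hlim).const_mul c
    rw [mul_zero] at this
    exact this.eventually_lt_const one_pos
  have e2 : ∀ᶠ t : ℕ in atTop, β * ((t : ℝ) + 1) ^ (-(1 - δ)) < c / 2 := by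
    have := ((tendsto_rpow_neg_atTop (sub_pos.2 hδ1)).comp hlim).const_mul β
    rw [mul_zero] at this
    exact this.eventually_lt_const (by positivity)
  obtain ⟨T, hT⟩ := eventually_atTop.1 (e1.and e2)
  refine ⟨max (max (2 * C / c) 0) (x T * ((T : ℝ) + 1) ^ β), eventually_atTop.2 ⟨T, ?_⟩⟩
  set K := max (max (2 * C / c) 0) (x T * ((T : ℝ) + 1) ^ β) with hK
  have hKC : 2 * C / c ≤ K := (le_max_left _ _).trans (le_max_left _ _)
  have hK0 : 0 ≤ K := (le_max_right _ _).trans (le_max_left _ _)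
  rw [div_le_iff₀ hc] at hKC
  intro t ht
  induction t, ht using Nat.le_induction with
  | base =>
    rw [Real.rpow_neg (by positivity), ← div_eq_mul_inv, le_div_iff₀ (by positivity)]
    exact le_max_right _ _
  | succ t ht ih =>
    obtain ⟨h1, h2⟩ := hT t ht
    have hs : (0 : ℝ) < t + 1 := by positivity
    have hd : ((t : ℝ) + 1) ^ (-(1 - δ)) * ((t : ℝ) + 1) ^ (-δ) = 1 / (t + 1) := by
      rw [← Real.rpow_add hs, show -(1 - δ) + -δ = -1 by ring, Real.rpow_neg_one, one_div]
    have hb : ((t : ℝ) + 1) ^ (-δ - β) = ((t : ℝ) + 1) ^ (-δ) * ((t : ℝ) + 1) ^ (-β) := by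
      rw [← Real.rpow_add hs]; rfl
    have hg := mul_le_mul_of_nonneg_left (add_two_rpow_neg_ge hβ t) hK0
    have hxt := hx t
    rw [hb] at hxt
    have hstep := mul_le_mul_of_nonneg_left ih (sub_nonneg.2 h1.le)
    set u := ((t : ℝ) + 1) ^ (-δ)
    set v := ((t : ℝ) + 1) ^ (-β)
    have hu : 0 < u := by positivity
    have hv : 0 < v := by positivity
    have hβu : β / (t + 1) ≤ c / 2 * u := by
      calc β / ((t : ℝ) + 1) = (β * ((t : ℝ) + 1) ^ (-(1 - δ))) * u := by
            rw [mul_assoc, hd]; ring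
        _ ≤ _ := by gcongr
    have hcast : ((t + 1 : ℕ) : ℝ) + 1 = t + 2 := by push_cast; ring
    rw [hcast]
    refine le_trans ?_ hg
    have h3 : K * v * (β / (t + 1)) ≤ K * v * (c / 2 * u) := by gcongr
    have h4 : 2 * C * (u * v) ≤ K * c * (u * v) := by gcongr
    linarith

/-- One step of the recursion for the moments of a process contracted by random factors. -/
lemma integral_pow_succ_contraction_le {Ω : Type*} {m m0 : MeasurableSpace Ω} {μ : Measure Ω}
    [IsProbabilityMeasure μ] (hm : m ≤ m0) {X r : Ω → ℝ} {p a B : ℝ} (hX : Measurable[m] X)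
    (hXB : ∀ᵐ ω ∂μ, 0 ≤ X ω ∧ X ω ≤ B) (hr : Measurable r)
    (hr01 : ∀ᵐ ω ∂μ, 0 ≤ r ω ∧ r ω ≤ 1) (hp : 0 < p) (hpr : ∀ᵐ ω ∂μ, p ≤ (μ[r | m]) ω)
    (ha : 0 ≤ a) (k : ℕ) :
    ∫ ω, ((1 - r ω) * X ω + a) ^ (k + 1) ∂μ ≤
      (1 - p / 2) * ∫ ω, X ω ^ (k + 1) ∂μ + a ^ (k + 1) / (p / (2 * (k + 1))) ^ k := by
  have hXm : Measurable X := hX.mono hm le_rfl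
  have hrint : Integrable r μ := by
    refine Integrable.of_bound hr.aestronglyMeasurable 1 ?_
    filter_upwards [hr01] with ω h
    rw [Real.norm_of_nonneg h.1]; exact h.2
  have hp1 : p ≤ 1 := by
    calc p = ∫ _, p ∂μ := by simp
      _ ≤ ∫ ω, (μ[r | m]) ω ∂μ := integral_mono_ae (integrable_const _) integrable_condExp hpr
      _ = ∫ ω, r ω ∂μ := integral_condExp hm
      _ ≤ ∫ _, (1 : ℝ) ∂μ := integral_mono_ae hrint (integrable_const _)
          (hr01.mono fun _ h => h.2)
      _ = 1 := by simp
  have hXpow : ∀ᵐ ω ∂μ, 0 ≤ X ω ^ (k + 1) ∧ X ω ^ (k + 1) ≤ B ^ (k + 1) := by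
    filter_upwards [hXB] with ω h
    exact ⟨pow_nonneg h.1 _, pow_le_pow_left₀ h.1 h.2 _⟩
  have hXint : Integrable (fun ω => X ω ^ (k + 1)) μ := by
    refine Integrable.of_bound (hXm.pow_const _).aestronglyMeasurable (B ^ (k + 1)) ?_
    filter_upwards [hXpow] with ω h
    rw [Real.norm_of_nonneg h.1]; exact h.2
  have hrXint : Integrable (fun ω => r ω * X ω ^ (k + 1)) μ := by
    refine hXint.mono (hr.mul (hXm.pow_const _)).aestronglyMeasurable ?_
    filter_upwards [hr01] with ω h
    rw [norm_mul, Real.norm_of_nonneg h.1]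
    exact mul_le_of_le_one_left (norm_nonneg _) h.2
  have hpull : μ[fun ω => r ω * X ω ^ (k + 1) | m] =ᵐ[μ]
      fun ω => (μ[r | m]) ω * X ω ^ (k + 1) :=
    condExp_mul_of_stronglyMeasurable_right (hX.pow_const _).stronglyMeasurable hrXint hrint
  have hlow : p * ∫ ω, X ω ^ (k + 1) ∂μ ≤ ∫ ω, r ω * X ω ^ (k + 1) ∂μ := by
    rw [← integral_condExp hm (f := fun ω => r ω * X ω ^ (k + 1)), ← integral_const_mul]
    refine integral_mono_ae (hXint.const_mul _) integrable_condExp ?_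
    filter_upwards [hpull, hpr, hXpow] with ω h1 h2 h3
    rw [h1]
    exact mul_le_mul_of_nonneg_right h2 h3.1
  set θ := p / (2 * ((k : ℝ) + 1)) with hθ
  have hθ0 : 0 < θ := by positivity
  have hθ1 : θ < 1 := by
    rw [hθ, div_lt_one (by positivity)]
    linarith [(k.cast_nonneg : (0 : ℝ) ≤ k)]
  have hpt : ∀ᵐ ω ∂μ, ((1 - r ω) * X ω + a) ^ (k + 1) ≤
      (X ω ^ (k + 1) - r ω * X ω ^ (k + 1)) / (1 - θ) ^ k + a ^ (k + 1) / θ ^ k := by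
    filter_upwards [hr01, hXB] with ω hrω hXω
    have h1r : 0 ≤ 1 - r ω := by linarith
    refine (add_pow_succ_le_div_add_div (mul_nonneg h1r hXω.1) ha hθ0 hθ1 k).trans ?_
    have h1 : (1 - r ω) ^ (k + 1) ≤ 1 - r ω :=
      pow_le_of_le_one h1r (by linarith) k.succ_ne_zero
    have h2 : ((1 - r ω) * X ω) ^ (k + 1) ≤ X ω ^ (k + 1) - r ω * X ω ^ (k + 1) := by
      rw [mul_pow]
      linarith [mul_le_mul_of_nonneg_right h1 (pow_nonneg hXω.1 (k + 1))]
    have h3 : 0 ≤ 1 - θ := by linarith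
    gcongr
  calc ∫ ω, ((1 - r ω) * X ω + a) ^ (k + 1) ∂μ
      ≤ ∫ ω, ((X ω ^ (k + 1) - r ω * X ω ^ (k + 1)) / (1 - θ) ^ k + a ^ (k + 1) / θ ^ k) ∂μ := by
        refine integral_mono_of_nonneg ?_
          (((hXint.sub hrXint).div_const _).add (integrable_const _)) hpt
        filter_upwards [hr01, hXB] with ω hrω hXω
        exact pow_nonneg (add_nonneg (mul_nonneg (by linarith) hXω.1) ha) _
    _ = (∫ ω, X ω ^ (k + 1) ∂μ - ∫ ω, r ω * X ω ^ (k + 1) ∂μ) / (1 - θ) ^ k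
          + a ^ (k + 1) / θ ^ k := by
        have hsub : Integrable (fun ω => X ω ^ (k + 1) - r ω * X ω ^ (k + 1)) μ :=
          hXint.sub hrXint
        rw [integral_add (hsub.div_const _) (integrable_const _), integral_div,
          integral_sub hXint hrXint]
        simp
    _ ≤ ((1 - p) * ∫ ω, X ω ^ (k + 1) ∂μ) / (1 - θ) ^ k + a ^ (k + 1) / θ ^ k := by
        have h3 : 0 ≤ 1 - θ := by linarith
        gcongr
        linarith
    _ = (1 - p) / (1 - θ) ^ k * ∫ ω, X ω ^ (k + 1) ∂μ + a ^ (k + 1) / θ ^ k := by ring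
    _ ≤ _ := by
        have := integral_nonneg_of_ae (hXpow.mono fun _ h => h.1)
        gcongr
        exact one_sub_div_pow_le hp.le hp1 k

/-- If the `(k + 1)`-th moments of nonnegative random variables are summable, then the variables
converge to zero almost surely. -/
lemma ae_tendsto_zero_of_summable_integral_pow {Ω : Type*} [MeasurableSpace Ω] {μ : Measure Ω}
    {X : ℕ → Ω → ℝ} {k : ℕ} (hX : ∀ t, ∀ᵐ ω ∂μ, 0 ≤ X t ω)
    (hint : ∀ t, Integrable (fun ω => X t ω ^ (k + 1)) μ)
    (hsum : Summable fun t => ∫ ω, X t ω ^ (k + 1) ∂μ) :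
    ∀ᵐ ω ∂μ, Tendsto (fun t => X t ω) atTop (nhds 0) := by
  have hnorm : ∀ t, eLpNorm (fun ω => X t ω ^ (k + 1)) 1 μ =
      ENNReal.ofReal (∫ ω, X t ω ^ (k + 1) ∂μ) := fun t => by
    rw [eLpNorm_one_eq_lintegral_enorm, ← ofReal_integral_norm_eq_lintegral_enorm (hint t)]
    congr 1
    refine integral_congr_ae ((hX t).mono fun ω h => ?_)
    exact Real.norm_of_nonneg (pow_nonneg h _)
  have hs := summable_norm_of_tsum_eLpNorm_ne_top (μ := μ) le_rfl
    (fun t => (hint t).aestronglyMeasurable) (by simpa only [hnorm] using hsum.tsum_ofReal_ne_top)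
  filter_upwards [hs, ae_all_iff.2 hX] with ω hω h0
  have h1 : Tendsto (fun t => X t ω ^ (k + 1)) atTop (nhds 0) :=
    (summable_norm_iff.1 hω).tendsto_atTop_zero
  have h2 := h1.rpow_const (p := ((k + 1 : ℕ) : ℝ)⁻¹) (Or.inr (by positivity))
  rw [Real.zero_rpow (by positivity)] at h2
  refine h2.congr fun t => ?_
  exact Real.pow_rpow_inv_natCast (h0 t) k.succ_ne_zero

/-- Almost sure decay rate of a process satisfying the recursive inequality, when each of its
terms is essentially bounded. -/
lemma ae_tendsto_rpow_mul_zero_of_bounded {Ω : Type*} [m0 : MeasurableSpace Ω] {μ : Measure Ω}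
    [IsProbabilityMeasure μ] {F : ℕ → MeasurableSpace Ω} (hFle : ∀ t, F t ≤ m0)
    {cr δ2 c1 δ1 : ℝ} (hcr : 0 < cr) (hδ2 : 0 < δ2) (hδ2' : δ2 < 1) (hc1 : 0 < c1)
    (hδ21 : δ2 < δ1) {r : ℕ → Ω → ℝ} (hr : ∀ t, Measurable (r t))
    (hr01 : ∀ t, ∀ᵐ ω ∂μ, 0 ≤ r t ω ∧ r t ω ≤ 1)
    (hrmean : ∀ t : ℕ, ∀ᵐ ω ∂μ, cr / ((t : ℝ) + 1) ^ δ2 ≤ (μ[r t | F t]) ω)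
    {X : ℕ → Ω → ℝ} (hX : ∀ t, Measurable[F t] (X t)) {B : ℕ → ℝ}
    (hXB : ∀ t, ∀ᵐ ω ∂μ, 0 ≤ X t ω ∧ X t ω ≤ B t)
    (hstep : ∀ t : ℕ, ∀ᵐ ω ∂μ,
      X (t + 1) ω ≤ (1 - r t ω) * X t ω + c1 / ((t : ℝ) + 1) ^ δ1)
    {δ0 : ℝ} (hδ01 : δ0 < δ1 - δ2) :
    ∀ᵐ ω ∂μ, Tendsto (fun t : ℕ => ((t : ℝ) + 1) ^ δ0 * X t ω) atTop (nhds 0) := by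
  obtain ⟨k, hk⟩ : ∃ k : ℕ, 1 < ((k : ℝ) + 1) * (δ1 - δ2 - δ0) := by
    obtain ⟨k, hk⟩ := exists_nat_gt (1 / (δ1 - δ2 - δ0))
    rw [div_lt_iff₀ (by linarith)] at hk
    exact ⟨k, by nlinarith⟩
  have hXm : ∀ t, Measurable (X t) := fun t => (hX t).mono (hFle t) le_rfl
  have hint : ∀ t, Integrable (fun ω => X t ω ^ (k + 1)) μ := fun t => by
    refine Integrable.of_bound ((hXm t).pow_const _).aestronglyMeasurable (B t ^ (k + 1)) ?_
    filter_upwards [hXB t] with ω h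
    rw [Real.norm_of_nonneg (pow_nonneg h.1 _)]
    exact pow_le_pow_left₀ h.1 h.2 _
  have hrec : ∀ t : ℕ, ∫ ω, X (t + 1) ω ^ (k + 1) ∂μ ≤
      (1 - cr / 2 * ((t : ℝ) + 1) ^ (-δ2)) * ∫ ω, X t ω ^ (k + 1) ∂μ +
        c1 ^ (k + 1) / (cr / (2 * (k + 1))) ^ k *
          ((t : ℝ) + 1) ^ (-δ2 - (k + 1) * (δ1 - δ2)) := by
    intro t
    have hs : (0 : ℝ) < t + 1 := by positivity
    have hmono : ∫ ω, X (t + 1) ω ^ (k + 1) ∂μ ≤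
        ∫ ω, ((1 - r t ω) * X t ω + c1 / ((t : ℝ) + 1) ^ δ1) ^ (k + 1) ∂μ := by
      refine integral_mono_of_nonneg ?_ ?_ ?_
      · filter_upwards [hXB (t + 1)] with ω h using pow_nonneg h.1 _
      · refine Integrable.of_bound ((((measurable_const.sub (hr t)).mul (hXm t)).add
          measurable_const).pow_const _).aestronglyMeasurable
          ((B t + c1 / ((t : ℝ) + 1) ^ δ1) ^ (k + 1)) ?_
        filter_upwards [hXB t, hr01 t] with ω h1 h2
        have h3 : 0 ≤ (1 - r t ω) * X t ω := mul_nonneg (by linarith) h1.1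
        have h4 : (1 - r t ω) * X t ω ≤ B t := by nlinarith
        rw [Real.norm_of_nonneg (by positivity)]
        gcongr
      · filter_upwards [hXB (t + 1), hstep t] with ω h1 h2
        exact pow_le_pow_left₀ h1.1 h2 _
    refine (hmono.trans (integral_pow_succ_contraction_le (hFle t) (hX t) (hXB t) (hr t) (hr01 t)
      (by positivity) (hrmean t) (by positivity) k)).trans_eq ?_
    have e1 : ((t : ℝ) + 1) ^ (-δ2 - (k + 1) * (δ1 - δ2)) =
        (((t : ℝ) + 1) ^ δ2) ^ k / (((t : ℝ) + 1) ^ δ1) ^ (k + 1) := by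
      rw [← Real.rpow_mul_natCast hs.le, ← Real.rpow_mul_natCast hs.le, ← Real.rpow_sub hs]
      congr 1
      push_cast
      ring
    rw [e1, Real.rpow_neg hs.le]
    congr 1
    · ring
    · simp only [div_pow]
      field_simp
  obtain ⟨K, hK⟩ := exists_eventually_le_rpow_neg_of_recursion
    (x := fun t => ∫ ω, X t ω ^ (k + 1) ∂μ) (half_pos hcr) hδ2 hδ2'
    (mul_nonneg (by positivity : (0 : ℝ) ≤ (k : ℝ) + 1) (sub_nonneg.2 hδ21.le)) hrec
  have hscale : ∀ t : ℕ, ∀ x : ℝ, (((t : ℝ) + 1) ^ δ0 * x) ^ (k + 1) =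
      ((t : ℝ) + 1) ^ ((k + 1) * δ0) * x ^ (k + 1) := fun t x => by
    rw [mul_pow, ← Real.rpow_mul_natCast (by positivity)]
    push_cast
    rw [mul_comm δ0]
  refine ae_tendsto_zero_of_summable_integral_pow (k := k) (fun t => ?_) (fun t => ?_) ?_
  · filter_upwards [hXB t] with ω h using mul_nonneg (by positivity) h.1
  · simp only [hscale]
    exact (hint t).const_mul _
  · simp only [hscale, integral_const_mul]
    have hsummable : Summable fun t : ℕ =>
        K * ((t : ℝ) + 1) ^ (-(((k : ℝ) + 1) * (δ1 - δ2 - δ0))) := by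
      refine Summable.mul_left _ ?_
      have := (summable_nat_add_iff 1).2 (Real.summable_nat_rpow.2
        (show -(((k : ℝ) + 1) * (δ1 - δ2 - δ0)) < -1 by linarith))
      simpa using this
    refine hsummable.of_norm_bounded_eventually_nat ?_
    filter_upwards [hK] with t ht
    have hs : (0 : ℝ) < t + 1 := by positivity
    have h0 : 0 ≤ ∫ ω, X t ω ^ (k + 1) ∂μ :=
      integral_nonneg_of_ae ((hXB t).mono fun _ h => pow_nonneg h.1 _)
    rw [Real.norm_of_nonneg (by positivity)]
    calc ((t : ℝ) + 1) ^ ((k + 1) * δ0) * ∫ ω, X t ω ^ (k + 1) ∂μ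
        ≤ ((t : ℝ) + 1) ^ ((k + 1) * δ0) *
            (K * ((t : ℝ) + 1) ^ (-((k + 1) * (δ1 - δ2)))) := by gcongr
      _ = K * (((t : ℝ) + 1) ^ ((k + 1) * δ0) *
            ((t : ℝ) + 1) ^ (-((k + 1) * (δ1 - δ2)))) := by ring
      _ = _ := by
        rw [← Real.rpow_add hs]
        congr 2
        ring

/-- Let `(F_t)` be a filtration and `{r(t)}` an `F_{t+1}`-adapted process with
`0 ≤ r(t) ≤ 1` a.s. and `E[r(t) | F_t] ≥ c_r/(t+1)^{δ₂}` a.s. for all `t`, where `c_r > 0`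
and `0 < δ₂ < 1`. Let `r₁(t) = c₁/(t+1)^{δ₁}` with `c₁ > 0`, `δ₂ < δ₁`. If `w₀ ≥ 0` is
`F₀`-measurable and `w_{t+1} = (1 − r(t)) w_t + r₁(t)`, then for every `0 ≤ δ₀ < δ₁ − δ₂`,
with probability 1, `lim_{t→∞} (t+1)^{δ₀} w_t = 0`. -/
theorem stmt8 {Ω : Type*} [m0 : MeasurableSpace Ω] (μ : Measure Ω) [IsProbabilityMeasure μ]
    (F : ℕ → MeasurableSpace Ω) (hFmono : Monotone F) (hFle : ∀ t, F t ≤ m0)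
    (cr δ2 c1 δ1 : ℝ) (hcr : 0 < cr) (hδ2 : 0 < δ2) (hδ2' : δ2 < 1)
    (hc1 : 0 < c1) (hδ21 : δ2 < δ1)
    (r : ℕ → Ω → ℝ) (hradapted : ∀ t, Measurable[F (t + 1)] (r t))
    (hr01 : ∀ t, ∀ᵐ ω ∂μ, 0 ≤ r t ω ∧ r t ω ≤ 1)
    (hrmean : ∀ t : ℕ, ∀ᵐ ω ∂μ, cr / ((t : ℝ) + 1) ^ δ2 ≤ (μ[r t | F t]) ω)
    (w : ℕ → Ω → ℝ)
    (hw0meas : Measurable[F 0] (w 0)) (hw0 : ∀ ω, 0 ≤ w 0 ω)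
    (hwdyn : ∀ t ω, w (t + 1) ω = (1 - r t ω) * w t ω + c1 / ((t : ℝ) + 1) ^ δ1) :
    ∀ δ0 : ℝ, 0 ≤ δ0 → δ0 < δ1 - δ2 →
      ∀ᵐ ω ∂μ, Tendsto (fun t : ℕ => ((t : ℝ) + 1) ^ δ0 * w t ω) atTop (nhds 0) := by
  intro δ0 _ hδ01
  have hwmeas : ∀ t, Measurable[F t] (w t) := by
    intro t
    induction t with
    | zero => exact hw0meas
    | succ t ih =>
      rw [funext (hwdyn t)]
      exact ((measurable_const.sub (hradapted t)).mul
        (ih.mono (hFmono t.le_succ) le_rfl)).add measurable_const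
  have hwbound : ∀ᵐ ω ∂μ, ∀ t : ℕ, 0 ≤ w t ω ∧
      w t ω ≤ w 0 ω + ∑ s ∈ Finset.range t, c1 / ((s : ℝ) + 1) ^ δ1 := by
    filter_upwards [ae_all_iff.2 hr01] with ω h t
    induction t with
    | zero => simpa using hw0 ω
    | succ t ih =>
      obtain ⟨h0, h1⟩ := h t
      have ha : 0 ≤ c1 / ((t : ℝ) + 1) ^ δ1 := by positivity
      rw [hwdyn, Finset.sum_range_succ]
      constructor <;> nlinarith
  have htrunc : ∀ M : ℕ, ∀ᵐ ω ∂μ, Tendsto (fun t : ℕ => ((t : ℝ) + 1) ^ δ0 *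
      {ω | w 0 ω ≤ M}.indicator (w t) ω) atTop (nhds 0) := by
    intro M
    have hA : ∀ t, MeasurableSet[F t] {ω | w 0 ω ≤ M} := fun t =>
      hFmono t.zero_le _ (measurableSet_le hw0meas measurable_const)
    refine ae_tendsto_rpow_mul_zero_of_bounded hFle hcr hδ2 hδ2' hc1 hδ21
      (fun t => (hradapted t).mono (hFle _) le_rfl) hr01 hrmean
      (fun t => (hwmeas t).indicator (hA t))
      (B := fun t => M + ∑ s ∈ Finset.range t, c1 / ((s : ℝ) + 1) ^ δ1)
      (fun t => ?_) (fun t => ?_) hδ01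
    · filter_upwards [hwbound] with ω h
      by_cases hω : w 0 ω ≤ M
      · rw [Set.indicator_of_mem (show ω ∈ {ω | w 0 ω ≤ M} from hω)]
        exact ⟨(h t).1, (h t).2.trans (by gcongr)⟩
      · rw [Set.indicator_of_notMem (show ω ∉ {ω | w 0 ω ≤ M} from hω)]
        exact ⟨le_rfl, by positivity⟩
    · refine Eventually.of_forall fun ω => ?_
      by_cases hω : w 0 ω ≤ M
      · simp only [Set.indicator_of_mem (show ω ∈ {ω | w 0 ω ≤ M} from hω)]
        exact (hwdyn t ω).le
      · simp only [Set.indicator_of_notMem (show ω ∉ {ω | w 0 ω ≤ M} from hω)]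
        rw [mul_zero, zero_add]
        positivity
  filter_upwards [ae_all_iff.2 htrunc] with ω h
  obtain ⟨M, hM⟩ := exists_nat_ge (w 0 ω)
  simpa only [Set.indicator_of_mem (show ω ∈ {ω | w 0 ω ≤ M} from hM)] using h M
end

section
/- Consider the scalar, time-varying dynamical system w_{t+1} = (1 − r₁(t)·c₃/((|w_t| + ĉ₃)(t+1)^{δ₃})) w_t + r₁(t)·c₄/(t+1)^{δ₄}, where r₁(t) = c₁/(t+1)^{δ₁}, the constants satisfy c₁, c₃, ĉ₃, c₄ > 0, 0 < δ₃ < δ₄ < δ₁, and δ₃ + δ₁ < 1, and w₀ ∈ ℝ is arbitrary. Then for every δ₀ with 0 ≤ δ₀ < δ₄ − δ₃, lim_{t→∞} (t+1)^{δ₀} w_t = 0. -/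
open Filter

/-- A nonnegative sequence with saturating decay `a t * x / (x + h)` dominating the perturbation
`b t` stays bounded. -/
theorem le_max_of_saturating_recursion {x a b : ℕ → ℝ} {h : ℝ} {T : ℕ} (hh : 0 < h)
    (hx : ∀ t, 0 ≤ x t) (ha : ∀ t, 0 ≤ a t)
    (hba : ∀ t ≥ T, b t ≤ a t / 2) (hbh : ∀ t ≥ T, b t ≤ h)
    (hrec : ∀ t ≥ T, x (t + 1) ≤ (1 - a t / (x t + h)) * x t + b t) :
    ∀ t ≥ T, x t ≤ max (x T) (2 * h) := by
  intro t ht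
  induction t, ht using Nat.le_induction with
  | base => exact le_max_left _ _
  | succ t ht ih =>
    have hpos : 0 < x t + h := by linarith [hx t]
    have hr := hrec t ht
    rcases le_total h (x t) with hxt | hxt
    · have hhalf : a t / 2 ≤ a t / (x t + h) * x t := by
        rw [div_mul_eq_mul_div, le_div_iff₀ hpos]
        nlinarith [ha t]
      linarith [hba t ht]
    · have hdec : 0 ≤ a t / (x t + h) * x t :=
        mul_nonneg (div_nonneg (ha t) hpos.le) (hx t)
      exact le_trans (by linarith [hbh t ht]) (le_max_right _ _)

theorem rpow_neg_mul_one_sub_div_le {s γ : ℝ} (hs : 0 < s) (hγ : 0 ≤ γ) :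
    s ^ (-γ) * (1 - γ / s) ≤ (s + 1) ^ (-γ) := by
  have hfac : s + 1 = s * (1 + 1 / s) := by field_simp
  have hu : 0 < 1 + 1 / s := by positivity
  rw [hfac, Real.mul_rpow hs.le hu.le]
  refine mul_le_mul_of_nonneg_left ?_ (Real.rpow_nonneg hs.le _)
  rw [Real.rpow_def_of_pos hu]
  have hlog : Real.log (1 + 1 / s) ≤ 1 / s := by
    linarith [Real.log_le_sub_one_of_pos hu]
  have hexp := Real.add_one_le_exp (Real.log (1 + 1 / s) * -γ)
  have hmul := mul_le_mul_of_nonneg_right hlog hγ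
  have hdiv : 1 / s * γ = γ / s := by ring
  linarith

/-- A linear contraction with rate `a t`, perturbed by `C * a t * (t + 1) ^ (-γ)`, decays at least
like `(t + 1) ^ (-γ)` as soon as `a t` dominates `1 / (t + 1)`. -/
theorem exists_le_mul_rpow_neg_of_recursion {x a : ℕ → ℝ} {κ γ C : ℝ} {T : ℕ}
    (hκ : 0 < κ) (hγ : 0 ≤ γ) (ha : ∀ t, 0 ≤ a t)
    (ha1 : ∀ t ≥ T, κ * a t ≤ 1)
    (hlarge : ∀ t ≥ T, γ / ((t : ℝ) + 1) ≤ κ * a t / 2)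
    (hrec : ∀ t ≥ T, x (t + 1) ≤ (1 - κ * a t) * x t + C * a t * ((t : ℝ) + 1) ^ (-γ)) :
    ∃ K, ∀ t ≥ T, x t ≤ K * ((t : ℝ) + 1) ^ (-γ) := by
  set K := max (x T * ((T : ℝ) + 1) ^ γ) (max 0 (2 * C / κ))
  have hK0 : 0 ≤ K := (le_max_left _ _).trans (le_max_right _ _)
  have hKC : 2 * C ≤ K * κ := by
    rw [← div_le_iff₀ hκ]
    exact (le_max_right _ _).trans (le_max_right _ _)
  refine ⟨K, fun t ht ↦ ?_⟩
  induction t, ht using Nat.le_induction with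
  | base =>
    have hT : (0 : ℝ) < (T : ℝ) + 1 := by positivity
    rw [Real.rpow_neg hT.le, ← div_eq_mul_inv, le_div_iff₀ (Real.rpow_pos_of_pos hT _)]
    exact le_max_left _ _
  | succ t ht ih =>
    have hs : (0 : ℝ) < (t : ℝ) + 1 := by positivity
    have hp : 0 ≤ ((t : ℝ) + 1) ^ (-γ) := Real.rpow_nonneg hs.le _
    have hstep := mul_le_mul_of_nonneg_left (rpow_neg_mul_one_sub_div_le hs hγ) hK0
    have hcontr := mul_le_mul_of_nonneg_left ih (sub_nonneg.2 (ha1 t ht))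
    have hcoef : (1 - κ * a t) * K + C * a t ≤ K * (1 - γ / ((t : ℝ) + 1)) := by
      nlinarith [mul_le_mul_of_nonneg_left (hlarge t ht) hK0,
        mul_le_mul_of_nonneg_right hKC (ha t)]
    have hmul := mul_le_mul_of_nonneg_right hcoef hp
    push_cast
    nlinarith [hrec t ht]

theorem tendsto_natCast_add_one_rpow_neg {p : ℝ} (hp : 0 < p) :
    Tendsto (fun t : ℕ ↦ ((t : ℝ) + 1) ^ (-p)) atTop (nhds 0) :=
  (tendsto_rpow_neg_atTop hp).comp
    (tendsto_atTop_add_const_right _ _ tendsto_natCast_atTop_atTop)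

theorem eventually_mul_natCast_add_one_rpow_neg_le {p ε : ℝ} (C : ℝ) (hp : 0 < p) (hε : 0 < ε) :
    ∀ᶠ t : ℕ in atTop, C * ((t : ℝ) + 1) ^ (-p) ≤ ε := by
  have hlim := (tendsto_natCast_add_one_rpow_neg hp).const_mul C
  rw [mul_zero] at hlim
  exact (hlim.eventually_lt_const hε).mono fun _ ht ↦ ht.le

/-- The scalar, time-varying dynamical system
`w_{t+1} = (1 − r₁(t)·c₃/((|w_t| + ĉ₃)(t+1)^{δ₃})) w_t + r₁(t)·c₄/(t+1)^{δ₄}`,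
with `r₁(t) = c₁/(t+1)^{δ₁}`, `c₁, c₃, ĉ₃, c₄ > 0`, `0 < δ₃ < δ₄ < δ₁` and
`δ₃ + δ₁ < 1`, satisfies `lim_{t→∞} (t+1)^{δ₀} w_t = 0` for every
`0 ≤ δ₀ < δ₄ − δ₃`. -/
theorem stmt10 (c1 c3 ch3 c4 δ1 δ3 δ4 : ℝ)
    (hc1 : 0 < c1) (hc3 : 0 < c3) (hch3 : 0 < ch3) (hc4 : 0 < c4)
    (hδ3 : 0 < δ3) (hδ34 : δ3 < δ4) (hδ41 : δ4 < δ1) (hδ31 : δ3 + δ1 < 1)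
    (w : ℕ → ℝ)
    (hdyn : ∀ t : ℕ,
      w (t + 1) =
        (1 - (c1 / ((t : ℝ) + 1) ^ δ1) * c3 / ((|w t| + ch3) * ((t : ℝ) + 1) ^ δ3)) * w t
          + (c1 / ((t : ℝ) + 1) ^ δ1) * c4 / ((t : ℝ) + 1) ^ δ4) :
    ∀ δ0 : ℝ, 0 ≤ δ0 → δ0 < δ4 - δ3 →
      Tendsto (fun t : ℕ => ((t : ℝ) + 1) ^ δ0 * w t) atTop (nhds 0) := by
  intro δ0 _ hδ0
  set γ := δ4 - δ3 with hγ
  have hγ0 : 0 < γ := sub_pos.2 hδ34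
  set a : ℕ → ℝ := fun t ↦ c1 * c3 * ((t : ℝ) + 1) ^ (-(δ1 + δ3)) with ha_def
  set C := c4 / c3 with hC
  set b : ℕ → ℝ := fun t ↦ C * a t * ((t : ℝ) + 1) ^ (-γ) with hb_def
  have hs (t : ℕ) : (0 : ℝ) < (t : ℝ) + 1 := by positivity
  have ha (t : ℕ) : 0 < a t := by
    have := hs t
    positivity
  have hb (t : ℕ) : 0 ≤ b t := by
    have := hs t
    have := ha t
    positivity
  have hb_eq (t : ℕ) : b t = c1 * c4 * ((t : ℝ) + 1) ^ (-(δ1 + δ4)) := by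
    have hexp : -(δ1 + δ4) = -(δ1 + δ3) + -γ := by rw [hγ]; ring
    simp only [hb_def, ha_def, hC]
    rw [hexp, Real.rpow_add (hs t)]
    field_simp
  have hstep (t : ℕ) : w (t + 1) = (1 - a t / (|w t| + ch3)) * w t + b t := by
    have hden : |w t| + ch3 ≠ 0 := by positivity
    have h1 := (Real.rpow_pos_of_pos (hs t) δ1).ne'
    have h3 := (Real.rpow_pos_of_pos (hs t) δ3).ne'
    have h4 := (Real.rpow_pos_of_pos (hs t) δ4).ne'
    rw [hdyn t, hb_eq]
    simp only [ha_def]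
    rw [Real.rpow_neg (hs t).le, Real.rpow_neg (hs t).le, Real.rpow_add (hs t),
      Real.rpow_add (hs t)]
    field_simp
  have ha_small : ∀ᶠ t in atTop, a t ≤ ch3 :=
    eventually_mul_natCast_add_one_rpow_neg_le _ (by linarith) hch3
  have hb_small : ∀ᶠ t in atTop, b t ≤ ch3 := by
    simp only [hb_eq]
    exact eventually_mul_natCast_add_one_rpow_neg_le _ (by linarith) hch3
  have hba : ∀ᶠ t in atTop, b t ≤ a t / 2 := by
    filter_upwards [eventually_mul_natCast_add_one_rpow_neg_le C hγ0 one_half_pos] with t ht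
    have := mul_le_mul_of_nonneg_left ht (ha t).le
    simp only [hb_def]
    linarith
  obtain ⟨T, hT⟩ := eventually_atTop.1 (ha_small.and (hb_small.and hba))
  have habs : ∀ t ≥ T, |w (t + 1)| ≤ (1 - a t / (|w t| + ch3)) * |w t| + b t := by
    intro t ht
    have hnonneg : 0 ≤ 1 - a t / (|w t| + ch3) := by
      rw [sub_nonneg, div_le_one (by positivity)]
      linarith [(hT t ht).1, abs_nonneg (w t)]
    rw [hstep t]
    refine (abs_add_le _ _).trans_eq ?_
    rw [abs_mul, abs_of_nonneg hnonneg, abs_of_nonneg (hb t)]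
  have hbound := le_max_of_saturating_recursion hch3 (fun t ↦ abs_nonneg (w t))
    (fun t ↦ (ha t).le) (fun t ht ↦ (hT t ht).2.2) (fun t ht ↦ (hT t ht).2.1) habs
  set M := max |w T| (2 * ch3)
  have hM0 : 0 ≤ M := (abs_nonneg _).trans (le_max_left _ _)
  set κ := (M + ch3)⁻¹ with hκ_def
  have hκ : 0 < κ := by positivity
  have hlarge : ∀ᶠ t : ℕ in atTop, γ / ((t : ℝ) + 1) ≤ κ * a t / 2 := by
    have hp : 0 < 1 - (δ1 + δ3) := by linarith
    filter_upwards [eventually_mul_natCast_add_one_rpow_neg_le γ hp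
      (show 0 < κ * (c1 * c3) / 2 by positivity)] with t ht
    have hmul := mul_le_mul_of_nonneg_right ht (Real.rpow_nonneg (hs t).le (-(δ1 + δ3)))
    rw [mul_assoc, ← Real.rpow_add (hs t),
      show -(1 - (δ1 + δ3)) + -(δ1 + δ3) = -1 by ring, Real.rpow_neg_one,
      ← div_eq_mul_inv] at hmul
    refine hmul.trans_eq ?_
    simp only [ha_def]
    ring
  obtain ⟨N, hN⟩ := eventually_atTop.1 hlarge
  obtain ⟨K, hK⟩ := exists_le_mul_rpow_neg_of_recursion (x := fun t ↦ |w t|) (C := C)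
    (T := max T N) hκ hγ0.le (fun t ↦ (ha t).le)
    (fun t ht ↦ by
      rw [hκ_def, inv_mul_le_one₀ (by positivity)]
      linarith [(hT t (le_of_max_le_left ht)).1])
    (fun t ht ↦ hN t (le_of_max_le_right ht))
    (fun t ht ↦ by
      have htT := le_of_max_le_left ht
      refine (habs t htT).trans (add_le_add_left ?_ _)
      refine mul_le_mul_of_nonneg_right (sub_le_sub_left ?_ _) (abs_nonneg _)
      rw [hκ_def, mul_comm, ← div_eq_mul_inv]
      exact div_le_div_of_nonneg_left (ha t).le (by positivity)
        (by linarith [hbound t htT]))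
  have hlim := (tendsto_natCast_add_one_rpow_neg (sub_pos.2 hδ0)).const_mul K
  rw [mul_zero] at hlim
  refine squeeze_zero_norm' ?_ hlim
  filter_upwards [eventually_ge_atTop (max T N)] with t ht
  have hpow := Real.rpow_nonneg (hs t).le δ0
  rw [Real.norm_eq_abs, abs_mul, abs_of_nonneg hpow]
  refine (mul_le_mul_of_nonneg_left (hK t ht) hpow).trans_eq ?_
  rw [show -(γ - δ0) = δ0 + -γ by ring, Real.rpow_add (hs t)]
  ring
end

section
/- Consider the coupled scalar recursion m̂_{t+1} = (1 − r₂(t)/(m_t + c₅)) m_t + r₁(t) and m_{t+1} = max(|m_t|, |m̂_{t+1}|), with initial condition m₀ ≥ 0, where r₁(t) = c₁/(t+1)^{δ₁}, r₂(t) = c₂/(t+1)^{δ₂}, and c₁, c₂, c₅ > 0, 0 < δ₂ < δ₁. Then there exists a finite time T such that m_t = m_T for all t ≥ T; in particular, sup_{t≥0} m_t < ∞. -/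
open Filter

/-- For the coupled scalar recursion
`m̂_{t+1} = (1 − r₂(t)/(m_t + c₅)) m_t + r₁(t)`,
`m_{t+1} = max(|m_t|, |m̂_{t+1}|)`, `m₀ ≥ 0`, with `r₁(t) = c₁/(t+1)^{δ₁}`,
`r₂(t) = c₂/(t+1)^{δ₂}`, `c₁, c₂, c₅ > 0`, `0 < δ₂ < δ₁`, the sequence `m_t`
becomes constant after a finite time `T`; in particular `sup_{t≥0} m_t < ∞`. -/
theorem stmt11 (c1 c2 c5 δ1 δ2 : ℝ)
    (hc1 : 0 < c1) (hc2 : 0 < c2) (hc5 : 0 < c5)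
    (hδ2 : 0 < δ2) (hδ21 : δ2 < δ1)
    (m mhat : ℕ → ℝ) (hm0 : 0 ≤ m 0)
    (hhat : ∀ t : ℕ,
      mhat (t + 1) =
        (1 - (c2 / ((t : ℝ) + 1) ^ δ2) / (m t + c5)) * m t + c1 / ((t : ℝ) + 1) ^ δ1)
    (hmax : ∀ t : ℕ, m (t + 1) = max |m t| |mhat (t + 1)|) :
    (∃ T : ℕ, ∀ t ≥ T, m t = m T) ∧ ∃ C : ℝ, ∀ t : ℕ, m t ≤ C := by
  have hstep : ∀ t, |m t| ≤ m (t + 1) := fun t => by rw [hmax]; exact le_max_left _ _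
  have hnonneg : ∀ t, 0 ≤ m t := by
    intro t
    cases t with
    | zero => exact hm0
    | succ t => exact (abs_nonneg _).trans (hstep t)
  have hmono : Monotone m := monotone_nat_of_le_succ fun t => (le_abs_self _).trans (hstep t)
  have hpos : 0 < m 1 := by
    rcases hm0.lt_or_eq with h | h
    · exact h.trans_le (hmono zero_le_one)
    · have h1 : mhat 1 = c1 := by
        have := hhat 0
        simpa [← h] using this
      have h2 : |mhat 1| ≤ m 1 := by rw [hmax 0]; exact le_max_right _ _
      rw [h1] at h2
      exact hc1.trans_le ((le_abs_self _).trans h2)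
  have hκ : 0 < m 1 / (m 1 + c5) := by positivity
  have hshift : Tendsto (fun t : ℕ => (t : ℝ) + 1) atTop atTop :=
    tendsto_atTop_add_const_right _ _ tendsto_natCast_atTop_atTop
  have hgap : ∀ᶠ t : ℕ in atTop, c1 / (m 1 / (m 1 + c5) * c2) ≤ ((t : ℝ) + 1) ^ (δ1 - δ2) :=
    ((tendsto_rpow_atTop (sub_pos.2 hδ21)).comp hshift).eventually_ge_atTop _
  have hsmall : ∀ᶠ t : ℕ in atTop, c2 / m 1 ≤ ((t : ℝ) + 1) ^ δ2 :=
    ((tendsto_rpow_atTop hδ2).comp hshift).eventually_ge_atTop _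
  obtain ⟨T, hT⟩ := eventually_atTop.1 ((hgap.and hsmall).and (eventually_ge_atTop 1))
  have hconst : ∀ t ≥ T, m (t + 1) = m t := by
    intro t ht
    obtain ⟨⟨hg, hs⟩, ht1⟩ := hT t ht
    have hbase : (0 : ℝ) < (t : ℝ) + 1 := by positivity
    have hp2 : 0 < ((t : ℝ) + 1) ^ δ2 := Real.rpow_pos_of_pos hbase _
    have hp1 : 0 < ((t : ℝ) + 1) ^ δ1 := Real.rpow_pos_of_pos hbase _
    have hm1 : m 1 ≤ m t := hmono ht1
    have hden : 0 < m t + c5 := by linarith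
    have hr1 : c1 / ((t : ℝ) + 1) ^ δ1 ≤
        m 1 / (m 1 + c5) * (c2 / ((t : ℝ) + 1) ^ δ2) := by
      rw [Real.rpow_sub hbase, div_le_div_iff₀ (by positivity) hp2] at hg
      rw [← mul_div_assoc, div_le_div_iff₀ hp1 hp2]
      linarith
    have hr2 : c2 / ((t : ℝ) + 1) ^ δ2 ≤ m t := by
      rw [div_le_iff₀ hpos] at hs
      refine le_trans ?_ hm1
      rw [div_le_iff₀ hp2]
      linarith
    have hr2pos : 0 < c2 / ((t : ℝ) + 1) ^ δ2 := div_pos hc2 hp2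
    have hr1pos : 0 < c1 / ((t : ℝ) + 1) ^ δ1 := div_pos hc1 hp1
    have hratio : m 1 / (m 1 + c5) ≤ m t / (m t + c5) := by
      rw [div_le_div_iff₀ (by linarith) hden]
      nlinarith
    have hratio1 : m t / (m t + c5) ≤ 1 := by
      rw [div_le_one hden]
      linarith
    have hform : mhat (t + 1) = m t - m t / (m t + c5) * (c2 / ((t : ℝ) + 1) ^ δ2) +
        c1 / ((t : ℝ) + 1) ^ δ1 := by
      rw [hhat]
      ring
    have hupper := mul_le_mul_of_nonneg_right hratio hr2pos.le
    have hlower := mul_le_mul_of_nonneg_right hratio1 hr2pos.le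
    rw [hmax, abs_of_nonneg (hnonneg t), max_eq_left]
    rw [hform, abs_le]
    constructor <;> linarith
  have hfinal : ∀ t ≥ T, m t = m T := fun t ht =>
    Nat.le_induction rfl (fun n hn ih => (hconst n hn).trans ih) t ht
  refine ⟨⟨T, hfinal⟩, m T, fun t => ?_⟩
  rcases le_total t T with h | h
  · exact hmono h
  · exact (hfinal t h).le
end

section
/- Consider the scalar, time-varying dynamical system w_{t+1} = (1 − r₁(t)·c₃/((|w_t| + ĉ₃)(t+1)^{δ₃})) w_t + r₁(t)·c₄/(t+1)^{δ₄}, where r₁(t) = c₁/(t+1)^{δ₁}, the constants satisfy c₁, c₃, ĉ₃, c₄ > 0, 0 < δ₃ < δ₄ < δ₁, and δ₃ + δ₁ < 1, and w₀ ∈ ℝ is arbitrary. Then the trajectory is uniformly bounded: sup_{t≥0} |w_t| < ∞. -/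
open Filter

/-- One step of the damped recursion `x ↦ (1 - a / (|x| + c)) x + b` with small step size `a ≤ c`
and drift `b ≤ a / 2` preserves every bound `M ≥ 2c`. -/
lemma abs_damped_step_le {a b c x M : ℝ} (ha : 0 < a) (hc : 0 < c) (hb : 0 ≤ b)
    (hac : a ≤ c) (hba : 2 * b ≤ a) (hM : 2 * c ≤ M) (hx : |x| ≤ M) :
    |(1 - a / (|x| + c)) * x + b| ≤ M := by
  have hx0 := abs_nonneg x
  have hden : 0 < |x| + c := by positivity
  have hle : a / (|x| + c) ≤ 1 := by rw [div_le_one hden]; linarith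
  have hstep : |(1 - a / (|x| + c)) * x + b| ≤ (1 - a / (|x| + c)) * |x| + b := by
    refine (abs_add_le _ _).trans ?_
    rw [abs_mul, abs_of_nonneg (sub_nonneg.2 hle), abs_of_nonneg hb]
  refine hstep.trans ?_
  rcases le_total c |x| with hcx | hcx
  · have hdrop : b ≤ a / (|x| + c) * |x| := by
      rw [div_mul_eq_mul_div, le_div_iff₀ hden]
      nlinarith
    linarith
  · have hnn : 0 ≤ a / (|x| + c) * |x| := by positivity
    linarith

/-- A real sequence whose absolute values eventually satisfy every large bound once they satisfy it
is bounded. -/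
lemma exists_abs_le_of_eventually_step {w : ℕ → ℝ} {m : ℝ}
    (h : ∀ᶠ t in atTop, ∀ M, m ≤ M → |w t| ≤ M → |w (t + 1)| ≤ M) :
    ∃ C, ∀ t, |w t| ≤ C := by
  obtain ⟨T, hT⟩ := eventually_atTop.1 h
  have htail : ∀ t, T ≤ t → |w t| ≤ max m |w T| := fun t ht =>
    Nat.le_induction (le_max_right _ _) (fun t ht ih => hT t ht _ (le_max_left _ _) ih) t ht
  obtain ⟨C, hC⟩ := ((Finset.range T).image fun t => |w t|).bddAbove
  refine ⟨max C (max m |w T|), fun t => ?_⟩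
  rcases lt_or_ge t T with ht | ht
  · exact le_max_of_le_left
      (hC (Finset.mem_coe.2 (Finset.mem_image_of_mem _ (Finset.mem_range.2 ht))))
  · exact le_max_of_le_right (htail t ht)

/-- The scalar, time-varying dynamical system
`w_{t+1} = (1 − r₁(t)·c₃/((|w_t| + ĉ₃)(t+1)^{δ₃})) w_t + r₁(t)·c₄/(t+1)^{δ₄}`,
with `r₁(t) = c₁/(t+1)^{δ₁}`, `c₁, c₃, ĉ₃, c₄ > 0`, `0 < δ₃ < δ₄ < δ₁` and
`δ₃ + δ₁ < 1`, has a uniformly bounded trajectory: `sup_{t≥0} |w_t| < ∞`. -/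
theorem stmt12 (c1 c3 ch3 c4 δ1 δ3 δ4 : ℝ)
    (hc1 : 0 < c1) (hc3 : 0 < c3) (hch3 : 0 < ch3) (hc4 : 0 < c4)
    (hδ3 : 0 < δ3) (hδ34 : δ3 < δ4) (hδ41 : δ4 < δ1) (hδ31 : δ3 + δ1 < 1)
    (w : ℕ → ℝ)
    (hdyn : ∀ t : ℕ,
      w (t + 1) =
        (1 - (c1 / ((t : ℝ) + 1) ^ δ1) * c3 / ((|w t| + ch3) * ((t : ℝ) + 1) ^ δ3)) * w t
          + (c1 / ((t : ℝ) + 1) ^ δ1) * c4 / ((t : ℝ) + 1) ^ δ4) :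
    ∃ C : ℝ, ∀ t : ℕ, |w t| ≤ C := by
  have htop : Tendsto (fun t : ℕ => (t : ℝ) + 1) atTop atTop :=
    tendsto_atTop_add_const_right _ _ tendsto_natCast_atTop_atTop
  have hsmall := ((tendsto_rpow_atTop (by linarith : 0 < δ1 + δ3)).comp htop).eventually_ge_atTop
    (c1 * c3 / ch3)
  have hdrift := ((tendsto_rpow_atTop (sub_pos.2 hδ34)).comp htop).eventually_ge_atTop
    (2 * c4 / c3)
  refine exists_abs_le_of_eventually_step (m := 2 * ch3) ?_
  filter_upwards [hsmall, hdrift] with t hs hd M hM hw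
  have ht : (0 : ℝ) < (t : ℝ) + 1 := by positivity
  simp only [Function.comp_apply] at hs hd
  rw [Real.rpow_add ht, div_le_iff₀ hch3] at hs
  rw [Real.rpow_sub ht] at hd
  rw [hdyn t]
  have hR := Real.rpow_pos_of_pos ht δ1
  have hS := Real.rpow_pos_of_pos ht δ3
  have hU := Real.rpow_pos_of_pos ht δ4
  generalize ((t : ℝ) + 1) ^ δ1 = R at *
  generalize ((t : ℝ) + 1) ^ δ3 = S at *
  generalize ((t : ℝ) + 1) ^ δ4 = U at *
  rw [div_le_div_iff₀ hc3 hS] at hd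
  rw [mul_comm (|w t| + ch3), ← div_div (c1 / R * c3)]
  refine abs_damped_step_le (by positivity) hch3 (by positivity) ?_ ?_ hM hw
  · rw [div_mul_eq_mul_div, div_div, div_le_iff₀ (by positivity)]
    linarith
  · rw [← mul_div_assoc, div_le_div_iff₀ hU hS]
    have := mul_le_mul_of_nonneg_left hd (by positivity : 0 ≤ c1 / R)
    linarith
end
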